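/- For every k ≥ 3, C^gr(N_k), where N_k carries the trivial grading, equals the T₂-ideal of F⟨Y,Z⟩ generated by the three polynomials [y₁, y₂, …, y_{k−1}] (left-normed commutator of length k−1), [y₁,y₂][y₃,y₄], and z₁. -/

import Mathlib

noncomputable section

/-- The free superalgebra `F⟨Y,Z⟩`: the free unital associative `F`-algebra on the
even variables `Sum.inl i` (representing `y_{i+1}`) and the odd variables
`Sum.inr j` (representing `z_{j+1}`). -/
abbrev FA (F : Type) [Field F] : Type := FreeAlgebra F (ℕ ⊕ ℕ)

variable (F : Type) [Field F]

/-- the even variable `y_{i+1}` -/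
def yv (i : ℕ) : FA F := FreeAlgebra.ι F (Sum.inl i)

/-- the odd variable `z_{j+1}` -/
def zv (j : ℕ) : FA F := FreeAlgebra.ι F (Sum.inr j)

/-- the constant term of an element of `F⟨Y,Z⟩` -/
def constTerm : FA F →ₐ[F] F := FreeAlgebra.lift F (fun _ => (0 : F))

/-- the commutator `[a,b] = ab - ba` -/
def brk {R : Type} [Ring R] (a b : R) : R := a * b - b * a

/-- the left-normed commutator `[a, l₁, l₂, …]` -/
def lnc {R : Type} [Ring R] (a : R) (l : List R) : R := l.foldl brk a

section SuperAlg

variable (B : Type) [Ring B] [Algebra F B]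

/-- the center of the (possibly non-unital) subalgebra of `B` whose underlying
subspace is `S`, as a submodule of `B` -/
def centerIn (S : Submodule F B) : Submodule F B where
  carrier := {x | x ∈ S ∧ ∀ y ∈ S, x * y = y * x}
  add_mem' := by
    rintro a b ⟨ha, ha'⟩ ⟨hb, hb'⟩
    exact ⟨S.add_mem ha hb, fun y hy => by rw [add_mul, mul_add, ha' y hy, hb' y hy]⟩
  zero_mem' := ⟨S.zero_mem, fun y _ => by rw [zero_mul, mul_zero]⟩
  smul_mem' := by
    rintro c a ⟨ha, ha'⟩
    exact ⟨S.smul_mem c ha, fun y hy => by rw [smul_mul_assoc, mul_smul_comm, ha' y hy]⟩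

variable (A0 A1 : Submodule F B)

/-- a graded substitution: an algebra evaluation sending each `yᵢ` into the even
component `A0` and each `zⱼ` into the odd component `A1` -/
def IsGSubst (φ : FA F →ₐ[F] B) : Prop :=
  (∀ i, φ (yv F i) ∈ A0) ∧ (∀ j, φ (zv F j) ∈ A1)

/-- the graded identities of the superalgebra with even part `A0` and odd part `A1` -/
def IdGr : Submodule F (FA F) where
  carrier := {f | ∀ φ : FA F →ₐ[F] B, IsGSubst F B A0 A1 φ → φ f = 0}
  add_mem' := by
    intro f g hf hg φ hφ
    rw [map_add, hf φ hφ, hg φ hφ, add_zero]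
  zero_mem' := fun φ _ => map_zero φ
  smul_mem' := by
    intro c f hf φ hφ
    rw [map_smul, hf φ hφ, smul_zero]

/-- the central graded polynomials of the superalgebra with even part `A0` and
odd part `A1`: the polynomials with zero constant term all of whose graded
evaluations lie in the center of the superalgebra -/
def CGr : Submodule F (FA F) where
  carrier := {f | constTerm F f = 0 ∧
    ∀ φ : FA F →ₐ[F] B, IsGSubst F B A0 A1 φ → φ f ∈ centerIn F B (A0 ⊔ A1)}
  add_mem' := by
    rintro f g ⟨hf0, hf⟩ ⟨hg0, hg⟩
    refine ⟨by rw [map_add, hf0, hg0, add_zero], fun φ hφ => ?_⟩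
    rw [map_add]
    exact (centerIn F B (A0 ⊔ A1)).add_mem (hf φ hφ) (hg φ hφ)
  zero_mem' :=
    ⟨map_zero _, fun φ _ => by
      rw [map_zero]; exact (centerIn F B (A0 ⊔ A1)).zero_mem⟩
  smul_mem' := by
    rintro c f ⟨hf0, hf⟩
    refine ⟨by rw [map_smul, hf0, smul_zero], fun φ hφ => ?_⟩
    rw [map_smul]
    exact (centerIn F B (A0 ⊔ A1)).smul_mem c (hf φ hφ)

end SuperAlg

/-- the space `P_n^{gr}` of multilinear graded polynomials of degree `n`,
spanned by `w_{σ(1)} ⋯ w_{σ(n)}` with `wᵢ ∈ {yᵢ, zᵢ}` -/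
def PnGr (n : ℕ) : Submodule F (FA F) :=
  Submodule.span F
    {m : FA F | ∃ (σ : Equiv.Perm (Fin n)) (w : Fin n → Bool),
      m = (List.ofFn fun i : Fin n =>
        if w (σ i) then zv F (σ i).val else yv F (σ i).val).prod}

/-- `dim P / (P ∩ C)` -/
def scodim (P C : Submodule F (FA F)) : ℕ :=
  Module.finrank F (↥P ⧸ Submodule.comap P.subtype C)

/-- `dim (P ⊓ C) / (P ⊓ I)` -/
def deltaDim (P C I : Submodule F (FA F)) : ℕ :=
  Module.finrank F (↥(P ⊓ C) ⧸ Submodule.comap (P ⊓ C).subtype (P ⊓ I))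

/-- the parity automorphism of `F⟨Y,Z⟩`, fixing the `yᵢ` and negating the `zⱼ` -/
def omegaFA : FA F →ₐ[F] FA F :=
  FreeAlgebra.lift F (fun v => match v with
    | Sum.inl i => FreeAlgebra.ι F (Sum.inl i)
    | Sum.inr j => - FreeAlgebra.ι F (Sum.inr j))

/-- an even (degree-0) element of the free superalgebra -/
def IsEvenFA (f : FA F) : Prop := omegaFA F f = f

/-- an odd (degree-1) element of the free superalgebra -/
def IsOddFA (f : FA F) : Prop := omegaFA F f = - f

/-- a graded endomorphism of the free superalgebra: sends `Y`-variables to even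
elements and `Z`-variables to odd elements -/
def IsT2Endo (φ : FA F →ₐ[F] FA F) : Prop :=
  (∀ i, IsEvenFA F (φ (yv F i))) ∧ (∀ j, IsOddFA F (φ (zv F j)))

/-- a T₂-space: a subspace invariant under all graded endomorphisms -/
def IsT2Space (V : Submodule F (FA F)) : Prop :=
  ∀ φ : FA F →ₐ[F] FA F, IsT2Endo F φ → ∀ f ∈ V, φ f ∈ V

/-- the smallest T₂-space of `F⟨Y,Z⟩` containing `S` -/
def T2SpaceGen (S : Set (FA F)) : Submodule F (FA F) :=
  sInf {V : Submodule F (FA F) | S ⊆ ↑V ∧ IsT2Space F V}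

/-- a T₂-ideal: a two-sided ideal invariant under all graded endomorphisms -/
def IsT2Ideal (I : Submodule F (FA F)) : Prop :=
  (∀ f ∈ I, ∀ g : FA F, g * f ∈ I ∧ f * g ∈ I) ∧ IsT2Space F I

/-- the smallest T₂-ideal of `F⟨Y,Z⟩` containing `S` -/
def T2IdealGen (S : Set (FA F)) : Submodule F (FA F) :=
  sInf {I : Submodule F (FA F) | S ⊆ ↑I ∧ IsT2Ideal F I}

/-- the products `z_{i₁}⋯z_{i_k} · w₁⋯w_s` where every `wⱼ` is a left-normed
commutator of weight ≥ 2 in the variables and `k + s ≥ 1`; proper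
ℤ₂-polynomials are the linear combinations of these -/
def properProds : Set (FA F) :=
  {p | ∃ (zs : List ℕ) (ws : List (FA F)),
      (∀ w ∈ ws, ∃ (v : ℕ ⊕ ℕ) (l : List (ℕ ⊕ ℕ)), l ≠ [] ∧
        w = lnc (FreeAlgebra.ι F v) (l.map (FreeAlgebra.ι F))) ∧
      1 ≤ zs.length + ws.length ∧
      p = (zs.map (zv F)).prod * ws.prod}

/-- the Jacobson radical `J(A)`, as an `F`-submodule of `A` -/
def Jrad (A : Type) [Ring A] [Algebra F A] : Submodule F A :=
  Submodule.restrictScalars F ((⊥ : Ideal A).jacobson)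

/-- `J' = J(A) ∩ Z(A)` -/
def Jprime (A : Type) [Ring A] [Algebra F A] : Submodule F A :=
  Jrad F A ⊓ Subalgebra.toSubmodule (Subalgebra.center F A)

/-- the matrix unit `e_{i+1,j+1}` (0-indexed position `(i,j)`) -/
def eMat (k i j : ℕ) : Matrix (Fin k) (Fin k) F :=
  Matrix.of fun a b => if (a : ℕ) = i ∧ (b : ℕ) = j then 1 else 0

/-- the matrix `E = e_{12} + e_{23} + ⋯ + e_{k-1,k}` -/
def EMat (k : ℕ) : Matrix (Fin k) (Fin k) F :=
  Matrix.of fun a b => if (a : ℕ) + 1 = (b : ℕ) then 1 else 0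

/-- `N_k = span_F{I_k, E, …, E^{k-2}, e_{12}, …, e_{1k}}` -/
def NkSub (k : ℕ) : Submodule F (Matrix (Fin k) (Fin k) F) :=
  Submodule.span F
    ({1} ∪ {x | ∃ m, 1 ≤ m ∧ m ≤ k - 2 ∧ x = EMat F k ^ m}
      ∪ {x | ∃ j, 1 ≤ j ∧ j ≤ k - 1 ∧ x = eMat F k 0 j})

/-- `A_k = span_F{e_{11}, E, …, E^{k-2}, e_{12}, …, e_{1k}}` -/
def AkSub (k : ℕ) : Submodule F (Matrix (Fin k) (Fin k) F) :=
  Submodule.span F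
    ({eMat F k 0 0} ∪ {x | ∃ m, 1 ≤ m ∧ m ≤ k - 2 ∧ x = EMat F k ^ m}
      ∪ {x | ∃ j, 1 ≤ j ∧ j ≤ k - 1 ∧ x = eMat F k 0 j})

/-- `B_k = span_F{e_{kk}, E, …, E^{k-2}, e_{1k}, …, e_{k-1,k}}` -/
def BkSub (k : ℕ) : Submodule F (Matrix (Fin k) (Fin k) F) :=
  Submodule.span F
    ({eMat F k (k - 1) (k - 1)} ∪ {x | ∃ m, 1 ≤ m ∧ m ≤ k - 2 ∧ x = EMat F k ^ m}
      ∪ {x | ∃ i, i ≤ k - 2 ∧ x = eMat F k i (k - 1)})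

/-- the even part of `Matrix (Fin k) (Fin k) F` under the elementary ℤ₂-grading
induced by `(0,1,…,1)`: matrices vanishing at the odd positions `(i,j)`
(those where exactly one of `i`, `j` equals the first index) -/
def matEvenPart (k : ℕ) : Submodule F (Matrix (Fin k) (Fin k) F) where
  carrier := {x | ∀ i j : Fin k, (((i : ℕ) = 0) ↔ ¬((j : ℕ) = 0)) → x i j = 0}
  add_mem' := by
    intro a b ha hb i j h
    simp [Matrix.add_apply, ha i j h, hb i j h]
  zero_mem' := by intro i j _; simp
  smul_mem' := by
    intro c a ha i j h
    simp [Matrix.smul_apply, ha i j h]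

/-- the odd part of `Matrix (Fin k) (Fin k) F` under the elementary ℤ₂-grading
induced by `(0,1,…,1)`: matrices vanishing at the even positions -/
def matOddPart (k : ℕ) : Submodule F (Matrix (Fin k) (Fin k) F) where
  carrier := {x | ∀ i j : Fin k, (((i : ℕ) = 0) ↔ ((j : ℕ) = 0)) → x i j = 0}
  add_mem' := by
    intro a b ha hb i j h
    simp [Matrix.add_apply, ha i j h, hb i j h]
  zero_mem' := by intro i j _; simp
  smul_mem' := by
    intro c a ha i j h
    simp [Matrix.smul_apply, ha i j h]

section Grassmann

variable (M : Type) [AddCommGroup M] [Module F M]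

/-- the main involution of the Grassmann (exterior) algebra, negating the
generators -/
def grassInvol : ExteriorAlgebra F M →ₐ[F] ExteriorAlgebra F M :=
  ExteriorAlgebra.lift F ⟨-(ExteriorAlgebra.ι F (M := M)), fun m => by
    simp [ExteriorAlgebra.ι_sq_zero]⟩

/-- the even (degree-0) part of the canonical ℤ₂-grading of the Grassmann
algebra: the span of `1` and the products of the generators of even length -/
def grEven : Submodule F (ExteriorAlgebra F M) :=
  LinearMap.ker ((grassInvol F M).toLinearMap - LinearMap.id)

/-- the odd (degree-1) part of the canonical ℤ₂-grading of the Grassmann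
algebra: the span of the products of the generators of odd length -/
def grOdd : Submodule F (ExteriorAlgebra F M) :=
  LinearMap.ker ((grassInvol F M).toLinearMap + LinearMap.id)

end Grassmann

end


section Algebraic

open MvPolynomial

/-- the commutative polynomial ring in the left variables `x_i` and the commutator variables `d_i` -/
abbrev SS (F : Type) [Field F] : Type := MvPolynomial (ℕ ⊕ ℕ) F

/-- index of the spanning set of the commutator ideal -/
abbrev IX : Type := List ℕ × ℕ × ℕ × List ℕ

/-- the monomial attached to an index -/
noncomputable def smon (F : Type) [Field F] (l : IX) : SS F :=
  (l.1.map fun i => X (Sum.inl i)).prod * (l.2.2.2.map fun i => X (Sum.inr i)).prod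

theorem exists_lift_of_commute (F : Type) [Field F] {σ A : Type} [Ring A] [Algebra F A]
    (a : σ → A) (h : ∀ i j, a i * a j = a j * a i) :
    ∃ φ : MvPolynomial σ F →ₐ[F] A, ∀ i, φ (X i) = a i := by
  have hc : IsMulCommutative (Algebra.adjoin F (Set.range a)) :=
    Algebra.isMulCommutative_adjoin F (by rintro _ ⟨i, rfl⟩ _ ⟨j, rfl⟩; exact h i j)
  let b : σ → Algebra.adjoin F (Set.range a) :=
    fun i => ⟨a i, Algebra.subset_adjoin ⟨i, rfl⟩⟩
  let _ : CommRing (Algebra.adjoin F (Set.range a)) :=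
    { (inferInstance : Ring (Algebra.adjoin F (Set.range a))) with
      mul_comm := fun x y => hc.is_comm.comm x y }
  refine ⟨(Algebra.adjoin F (Set.range a)).val.comp (aeval b), fun i => ?_⟩
  simp [b]

theorem exists_lift_two (F : Type) [Field F] {A : Type} [Ring A] [Algebra F A]
    (L R : ℕ → A) (hLL : ∀ i j, L i * L j = L j * L i) (hLR : ∀ i j, L i * R j = R j * L i)
    (hRR : ∀ i j, R i * R j = R j * R i) :
    ∃ φ : SS F →ₐ[F] A, (∀ i, φ (X (Sum.inl i)) = L i) ∧
      ∀ i, φ (X (Sum.inr i)) = R i - L i := by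
  have cLL : ∀ g h, Commute (L g) (L h) := hLL
  have cLR : ∀ g h, Commute (L g) (R h) := hLR
  have cRR : ∀ g h, Commute (R g) (R h) := hRR
  obtain ⟨φ, hφ⟩ := exists_lift_of_commute F (Sum.elim L (fun i => R i - L i)) (by
    rintro (i | i) (j | j)
    · exact hLL _ _
    · exact (cLR _ _).sub_right (cLL _ _)
    · exact ((cLR _ _).sub_right (cLL _ _)).symm
    · exact ((cRR _ _).sub_right (cLR _ _).symm).sub_left ((cLR _ _).sub_right (cLL _ _)))
  exact ⟨φ, fun i => hφ _, fun i => hφ _⟩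

theorem euler_word {F : Type} [Field F] {V : Type} [AddCommGroup V] [Module F V] [Module (SS F) V]
    (ε : Derivation F (SS F) V) (w : V)
    (h1 : ∀ i, ε (X (Sum.inl i)) = 0) (h2 : ∀ i, ε (X (Sum.inr i)) = (X (Sum.inr i) : SS F) • w)
    (l : IX) : ε (smon F l) = l.2.2.2.length • (smon F l • w) := by
  obtain ⟨u, a, b, v⟩ := l
  have hu : ε (u.map fun i => (X (Sum.inl i) : SS F)).prod = 0 := by
    induction u with
    | nil => simp
    | cons i u ih => simp [h1, ih]
  have hv : ε (v.map fun i => (X (Sum.inr i) : SS F)).prod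
      = v.length • ((v.map fun i => (X (Sum.inr i) : SS F)).prod • w) := by
    induction v with
    | nil => simp
    | cons i v ih =>
      simp only [List.map_cons, List.prod_cons, Derivation.leibniz, ih, h2, List.length_cons,
        add_smul, one_smul, ← mul_smul, smul_comm _ v.length]
      rw [mul_comm (List.prod _)]
  simp only [smon, Derivation.leibniz, hu, hv, smul_zero, add_zero, ← mul_smul,
    smul_comm _ v.length]

theorem koszul_core {F : Type} [Field F] [CharZero F] {V : Type} [AddCommGroup V] [Module F V]
    [Module (SS F) V] [IsScalarTower F (SS F) V] (w : ℕ → ℕ → V)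
    (hanti : ∀ a b, w b a = - w a b)
    (hjac : ∀ i a b, (X (Sum.inr b) : SS F) • w i a - (X (Sum.inr a) : SS F) • w i b
      = - ((X (Sum.inr i) : SS F) • w a b))
    (n : ℕ) (A : Finset IX) (c : IX → F) (hA : ∀ l ∈ A, l.2.2.2.length = n)
    (H : ∀ j : ℕ, ∑ l ∈ A, c l • (smon F l * ((if l.2.1 = j then X (Sum.inr l.2.2.1) else 0)
      - (if l.2.2.1 = j then X (Sum.inr l.2.1) else 0))) = 0) :
    ∑ l ∈ A, c l • (smon F l • w l.2.1 l.2.2.1) = 0 := by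
  classical
  let δ : ℕ → Derivation F (SS F) V := fun j =>
    mkDerivation F (Sum.elim (fun _ => (0 : V)) (fun i => w i j))
  have key : ∀ l ∈ A, δ l.2.1 (smon F l * X (Sum.inr l.2.2.1))
      - δ l.2.2.1 (smon F l * X (Sum.inr l.2.1))
      = - ((n + 2 : ℕ) • (smon F l • w l.2.1 l.2.2.1)) := by
    intro l hl
    set a := l.2.1
    set b := l.2.2.1
    let ε : Derivation F (SS F) V :=
      (X (Sum.inr a) : SS F) • δ b - (X (Sum.inr b) : SS F) • δ a
    have he := euler_word ε (w a b) (fun i => by simp [ε, δ])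
      (fun i => by
        have := hjac i a b
        simp only [ε, δ, Derivation.sub_apply, Derivation.smul_apply, mkDerivation_X, Sum.elim_inr]
        rw [← neg_sub, this, neg_neg]) l
    rw [hA l hl] at he
    simp only [ε, Derivation.sub_apply, Derivation.smul_apply] at he
    simp only [Derivation.leibniz]
    have e1 : δ a (X (Sum.inr b)) = - w a b := by simp [δ, hanti a b]
    have e2 : δ b (X (Sum.inr a)) = w a b := by simp [δ]
    rw [e1, e2, add_smul, ← he, smul_neg, two_smul]
    abel
  let B : Finset ℕ := A.image (fun l => l.2.1) ∪ A.image (fun l => l.2.2.1)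
  have h0 : ∑ j ∈ B, δ j (∑ l ∈ A, c l • (smon F l *
      ((if l.2.1 = j then X (Sum.inr l.2.2.1) else 0)
      - (if l.2.2.1 = j then X (Sum.inr l.2.1) else 0)))) = 0 :=
    Finset.sum_eq_zero fun j _ => by rw [H j, map_zero]
  simp only [map_sum, Derivation.map_smul] at h0
  rw [Finset.sum_comm] at h0
  have h1 : ∀ l ∈ A, ∑ j ∈ B, c l • δ j (smon F l *
      ((if l.2.1 = j then X (Sum.inr l.2.2.1) else 0)
      - (if l.2.2.1 = j then X (Sum.inr l.2.1) else 0)))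
      = (-((n + 2 : ℕ) : F)) • (c l • (smon F l • w l.2.1 l.2.2.1)) := by
    intro l hl
    have : ∀ j, δ j (smon F l *
      ((if l.2.1 = j then X (Sum.inr l.2.2.1) else 0)
      - (if l.2.2.1 = j then X (Sum.inr l.2.1) else 0)))
      = (if l.2.1 = j then δ j (smon F l * X (Sum.inr l.2.2.1)) else 0)
        - (if l.2.2.1 = j then δ j (smon F l * X (Sum.inr l.2.1)) else 0) := by
      intro j
      rw [mul_sub, map_sub]
      congr 1 <;> split_ifs <;> simp
    rw [← Finset.smul_sum]
    simp only [this, Finset.sum_sub_distrib, Finset.sum_ite_eq]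
    rw [if_pos, if_pos, key l hl, neg_smul, Nat.cast_smul_eq_nsmul, smul_neg,
      smul_comm (n + 2) (c l)]
    · exact Finset.mem_union_right _ (Finset.mem_image_of_mem (fun l : IX => l.2.2.1) hl)
    · exact Finset.mem_union_left _ (Finset.mem_image_of_mem (fun l : IX => l.2.1) hl)
  rw [Finset.sum_congr rfl h1, ← Finset.smul_sum] at h0
  refine (smul_eq_zero.mp h0).resolve_left ?_
  exact neg_ne_zero.mpr (Nat.cast_ne_zero.mpr (by omega))

/-- the word `y_u [y_a, y_b, y_v]` -/
def wrd {Q : Type} [Ring Q] (y : ℕ → Q) (l : IX) : Q :=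
  (l.1.map y).prod * lnc (y l.2.1) ((l.2.2.1 :: l.2.2.2).map y)

theorem metab_core {F : Type} [Field F] [CharZero F] {Q : Type} [Ring Q] [Algebra F Q]
    (hQ : ∀ a b c d : Q, brk a b * brk c d = 0) (y : ℕ → Q)
    (n : ℕ) (A : Finset IX) (c : IX → F) (hA : ∀ l ∈ A, l.2.2.2.length = n)
    (H : ∀ j : ℕ, ∑ l ∈ A, c l • (smon F l * ((if l.2.1 = j then X (Sum.inr l.2.2.1) else 0)
      - (if l.2.2.1 = j then X (Sum.inr l.2.1) else 0))) = 0) :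
    ∑ l ∈ A, c l • wrd y l = 0 := by
  let V : Submodule F Q :=
    { carrier := {q | ∀ a b, q * brk a b = 0 ∧ brk a b * q = 0}
      add_mem' := fun {p q} hp hq a b => by
        rw [add_mul, mul_add, (hp a b).1, (hp a b).2, (hq a b).1, (hq a b).2]; simp
      zero_mem' := fun a b => by simp
      smul_mem' := fun c q hq a b => by
        rw [smul_mul_assoc, mul_smul_comm, (hq a b).1, (hq a b).2]; simp }
  have hVl : ∀ g q, q ∈ V → g * q ∈ V := fun g q hq a b => by
    refine ⟨by rw [mul_assoc, (hq a b).1, mul_zero], ?_⟩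
    have : brk a b * (g * q) = brk a (b * g) * q - b * (brk a g * q) := by
      simp only [brk]; noncomm_ring
    rw [this, (hq _ _).2, (hq _ _).2]; simp
  have hVr : ∀ g q, q ∈ V → q * g ∈ V := fun g q hq a b => by
    refine ⟨?_, by rw [← mul_assoc, (hq a b).2, zero_mul]⟩
    have : q * g * brk a b = q * brk (g * a) b - q * brk g b * a := by
      simp only [brk]; noncomm_ring
    rw [this, (hq _ _).1, (hq _ _).1]; simp
  have hVb : ∀ a b, brk a b ∈ V := fun a b c d => ⟨hQ _ _ _ _, hQ _ _ _ _⟩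
  let L : Q → Module.End F V := fun g =>
    { toFun := fun q => ⟨g * q, hVl g q q.2⟩
      map_add' := fun p q => by ext; simp [mul_add]
      map_smul' := fun c q => by ext; simp }
  let R : Q → Module.End F V := fun g =>
    { toFun := fun q => ⟨q * g, hVr g q q.2⟩
      map_add' := fun p q => by ext; simp [add_mul]
      map_smul' := fun c q => by ext; simp }
  have hLR : ∀ g h, L g * R h = R h * L g := fun g h => by
    ext q; simp [L, R, mul_assoc]
  have hLL : ∀ g h, L g * L h = L h * L g := fun g h => by
    ext q
    have := (q.2 g h).2
    simp only [brk, sub_mul, sub_eq_zero] at this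
    simp [L, ← mul_assoc, this]
  have hRR : ∀ g h, R g * R h = R h * R g := fun g h => by
    ext q
    have := (q.2 h g).1
    simp only [brk, mul_sub, sub_eq_zero] at this
    simp [R, mul_assoc, this]
  obtain ⟨θ, hθl, hθr⟩ := exists_lift_two F (A := Module.End F V) (fun i => L (y i))
    (fun i => R (y i)) (fun _ _ => hLL _ _) (fun _ _ => hLR _ _) (fun _ _ => hRR _ _)
  let _ : Module (SS F) V := Module.compHom V θ.toRingHom
  have hsm : ∀ (s : SS F) (q : V), s • q = θ s q := fun _ _ => rfl
  have : IsScalarTower F (SS F) V := ⟨fun a s q => by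
    rw [hsm, hsm, map_smul, LinearMap.smul_apply]⟩
  have hl : ∀ i (q : V), (((X (Sum.inl i) : SS F) • q : V) : Q) = y i * q := fun i q => by
    rw [hsm, hθl]; rfl
  have hd : ∀ i (q : V), (((X (Sum.inr i) : SS F) • q : V) : Q) = brk (q : Q) (y i) := fun i q => by
    rw [hsm, hθr]; rfl
  let w : ℕ → ℕ → V := fun a b => ⟨brk (y a) (y b), hVb _ _⟩
  have hw : ∀ l : IX, ((smon F l • w l.2.1 l.2.2.1 : V) : Q) = wrd y l := by
    rintro ⟨u, a, b, v⟩
    have h1 : ∀ (v : List ℕ) (q : V), (((v.map fun i => (X (Sum.inr i) : SS F)).prod • q : V) : Q)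
        = lnc (q : Q) (v.map y) := by
      intro v
      induction v with
      | nil => intro q; simp [lnc]
      | cons i v ih =>
        intro q
        rw [List.map_cons, List.prod_cons, mul_comm, mul_smul, ih, hd]
        simp [lnc]
    have h2 : ∀ (u : List ℕ) (q : V), (((u.map fun i => (X (Sum.inl i) : SS F)).prod • q : V) : Q)
        = (u.map y).prod * q := by
      intro u
      induction u with
      | nil => intro q; simp
      | cons i v ih =>
        intro q
        rw [List.map_cons, List.prod_cons, mul_smul, hl, ih]
        simp [mul_assoc]
    simp only [smon, mul_smul, h1, h2, wrd]
    simp [lnc, w]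
  have := koszul_core (F := F) w (fun a b => by ext; simp [w, brk])
    (fun i a b => by
      ext
      rw [Submodule.coe_sub, Submodule.coe_neg, hd, hd, hd]
      simp only [w, brk]; noncomm_ring) n A c hA H
  have h2 := congrArg (Subtype.val) this
  rw [← Submodule.coe_subtype, map_sum] at h2
  simpa [hw] using h2

end Algebraic

section MatrixPart

variable {F : Type} [Field F] {k : ℕ}

theorem brk_zero_left {R : Type} [Ring R] (a : R) : brk 0 a = 0 := by simp [brk]

theorem lnc_append {R : Type} [Ring R] (a : R) (l m : List R) :
    lnc a (l ++ m) = lnc (lnc a l) m := by simp [lnc]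

theorem lnc_map {R T : Type} [Ring R] [Ring T] (φ : R →+* T) (a : R) (l : List R) :
    φ (lnc a l) = lnc (φ a) (l.map φ) := by
  induction l generalizing a with
  | nil => rfl
  | cons x l ih =>
    have : lnc a (x :: l) = lnc (brk a x) l := rfl
    rw [this, ih]
    simp [lnc, brk]

theorem EMat_pow_apply (m : ℕ) (a b : Fin k) :
    (EMat F k ^ m) a b = if (a : ℕ) + m = b then 1 else 0 := by
  induction m generalizing a b with
  | zero => simp [Matrix.one_apply, Fin.ext_iff]
  | succ m ih =>
    rw [pow_succ, Matrix.mul_apply]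
    simp only [ih, ite_mul, one_mul, zero_mul]
    by_cases h : (a : ℕ) + m < k
    · rw [Finset.sum_eq_single (⟨a + m, h⟩ : Fin k)]
      · simp [EMat, add_assoc]
      · intro x _ hx
        rw [if_neg]
        intro h'
        exact hx (Fin.ext h'.symm)
      · simp
    · rw [Finset.sum_eq_zero, if_neg]
      · have := b.2; omega
      · intro x _
        rw [if_neg]
        have := x.2; omega

theorem ee_zero {j : ℕ} (h : k ≤ j) : eMat F k 0 j = 0 := by
  ext a b
  have := b.2
  simp only [eMat, Matrix.of_apply, Matrix.zero_apply]
  rw [if_neg]; omega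

theorem ee_mul_apply (j : ℕ) (M : Matrix (Fin k) (Fin k) F) (a b : Fin k) :
    (eMat F k 0 j * M) a b = if h : j < k then (if (a : ℕ) = 0 then M ⟨j, h⟩ b else 0) else 0 := by
  split_ifs with h h'
  · rw [Matrix.mul_apply, Finset.sum_eq_single (⟨j, h⟩ : Fin k)]
    · simp [eMat, h']
    · intro x _ hx
      have : (x : ℕ) ≠ j := fun h => hx (Fin.ext h)
      simp [eMat, this]
    · simp
  · rw [Matrix.mul_apply, Finset.sum_eq_zero]
    intro x _
    simp [eMat, h']
  · rw [ee_zero (by omega)]; simp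

theorem ee_mul_pow (j m : ℕ) : eMat F k 0 j * EMat F k ^ m = eMat F k 0 (j + m) := by
  ext a b
  rw [ee_mul_apply]
  simp only [EMat_pow_apply, eMat, Matrix.of_apply]
  have := b.2
  split_ifs <;> first | rfl | omega

theorem ee_mul_ee {i : ℕ} (hi : 1 ≤ i) (j : ℕ) : eMat F k 0 i * eMat F k 0 j = 0 := by
  ext a b
  rw [ee_mul_apply]
  simp only [eMat, Matrix.of_apply, Matrix.zero_apply]
  split_ifs <;> first | rfl | omega

theorem pow_mul_ee {m : ℕ} (hm : 1 ≤ m) (j : ℕ) : EMat F k ^ m * eMat F k 0 j = 0 := by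
  ext a b
  rw [Matrix.mul_apply, Finset.sum_eq_zero]
  · rfl
  intro x _
  rw [EMat_pow_apply]
  simp only [eMat, Matrix.of_apply]
  split_ifs <;> first | omega | simp

theorem ee_mem {j : ℕ} (hj : 1 ≤ j) : eMat F k 0 j ∈ NkSub F k := by
  by_cases h : j ≤ k - 1
  · exact Submodule.subset_span (Or.inr ⟨j, hj, h, rfl⟩)
  · rw [ee_zero (by omega)]; exact Submodule.zero_mem _

theorem pow_mem' (hk : 3 ≤ k) (m : ℕ) : EMat F k ^ m ∈ NkSub F k := by
  rcases Nat.eq_zero_or_pos m with rfl | hm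
  · exact Submodule.subset_span (Or.inl (Or.inl (by simp)))
  by_cases h : m ≤ k - 2
  · exact Submodule.subset_span (Or.inl (Or.inr ⟨m, hm, h, rfl⟩))
  · have : EMat F k ^ m = eMat F k 0 m := by
      ext a b
      have := b.2
      simp only [EMat_pow_apply, eMat, Matrix.of_apply]
      split_ifs <;> first | rfl | omega
    rw [this]; exact ee_mem hm

/-- induction over `N_k` -/
theorem Nk_ind {P : Matrix (Fin k) (Fin k) F → Prop} (h0 : P 0) (hadd : ∀ x y, P x → P y → P (x + y))
    (hsmul : ∀ (c : F) x, P x → P (c • x)) (hE : ∀ m, P (EMat F k ^ m))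
    (he : ∀ j, 1 ≤ j → P (eMat F k 0 j)) {x} (hx : x ∈ NkSub F k) : P x := by
  refine Submodule.span_induction (p := fun x _ => P x) ?_ h0 (fun x y _ _ => hadd x y)
    (fun c x _ => hsmul c x) hx
  rintro x ((rfl | ⟨m, _, _, rfl⟩) | ⟨j, hj, _, rfl⟩)
  · simpa using hE 0
  · exact hE m
  · exact he j hj

/-- top row matrices supported in the columns `≥ m` -/
def TR (F : Type) [Field F] (k m : ℕ) : Submodule F (Matrix (Fin k) (Fin k) F) :=
  Submodule.span F {x | ∃ j, m ≤ j ∧ x = eMat F k 0 j}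

theorem ee_TR {m j : ℕ} (h : m ≤ j) : eMat F k 0 j ∈ TR F k m :=
  Submodule.subset_span ⟨j, h, rfl⟩

theorem TR_ind {m : ℕ} {P : Matrix (Fin k) (Fin k) F → Prop} (h0 : P 0)
    (hadd : ∀ x y, P x → P y → P (x + y))
    (hsmul : ∀ (c : F) x, P x → P (c • x))
    (he : ∀ j, m ≤ j → P (eMat F k 0 j)) {x} (hx : x ∈ TR F k m) : P x := by
  refine Submodule.span_induction (p := fun x _ => P x) ?_ h0 (fun x y _ _ => hadd x y)
    (fun c x _ => hsmul c x) hx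
  rintro x ⟨j, hj, rfl⟩
  exact he j hj

theorem Nk_mul (hk : 3 ≤ k) {x y : Matrix (Fin k) (Fin k) F} (hx : x ∈ NkSub F k)
    (hy : y ∈ NkSub F k) : x * y ∈ NkSub F k := by
  refine Nk_ind (P := fun x => x * y ∈ NkSub F k) (by simp)
    (fun a b ha hb => by rw [add_mul]; exact Submodule.add_mem _ ha hb)
    (fun c a ha => by rw [smul_mul_assoc]; exact Submodule.smul_mem _ _ ha) ?_ ?_ hx
  · intro m
    refine Nk_ind (P := fun y => EMat F k ^ m * y ∈ NkSub F k) (by simp)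
      (fun a b ha hb => by rw [mul_add]; exact Submodule.add_mem _ ha hb)
      (fun c a ha => by rw [mul_smul_comm]; exact Submodule.smul_mem _ _ ha) ?_ ?_ hy
    · intro n; rw [← pow_add]; exact pow_mem' hk _
    · intro j hj
      rcases Nat.eq_zero_or_pos m with rfl | hm
      · simpa using ee_mem hj
      · rw [pow_mul_ee hm]; exact Submodule.zero_mem _
  · intro i hi
    refine Nk_ind (P := fun y => eMat F k 0 i * y ∈ NkSub F k) (by simp)
      (fun a b ha hb => by rw [mul_add]; exact Submodule.add_mem _ ha hb)
      (fun c a ha => by rw [mul_smul_comm]; exact Submodule.smul_mem _ _ ha) ?_ ?_ hy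
    · intro n; rw [ee_mul_pow]; exact ee_mem (by omega)
    · intro j hj
      rw [ee_mul_ee hi]; exact Submodule.zero_mem _

theorem TR_mul {m : ℕ} (hm : 1 ≤ m) {x y : Matrix (Fin k) (Fin k) F} (hx : x ∈ TR F k m)
    (hy : y ∈ NkSub F k) : x * y ∈ TR F k m ∧ y * x ∈ TR F k m ∧ brk x y ∈ TR F k (m + 1) := by
  have hz : ∀ n, (0 : Matrix (Fin k) (Fin k) F) ∈ TR F k n := fun n => Submodule.zero_mem _
  refine TR_ind (P := fun x => x * y ∈ TR F k m ∧ y * x ∈ TR F k m ∧ brk x y ∈ TR F k (m + 1))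
    (by simp [brk])
    (fun a b ha hb => by
      refine ⟨by rw [add_mul]; exact Submodule.add_mem _ ha.1 hb.1,
        by rw [mul_add]; exact Submodule.add_mem _ ha.2.1 hb.2.1, ?_⟩
      have : brk (a + b) y = brk a y + brk b y := by simp only [brk]; noncomm_ring
      rw [this]; exact Submodule.add_mem _ ha.2.2 hb.2.2)
    (fun c a ha => by
      refine ⟨by rw [smul_mul_assoc]; exact Submodule.smul_mem _ _ ha.1,
        by rw [mul_smul_comm]; exact Submodule.smul_mem _ _ ha.2.1, ?_⟩
      have : brk (c • a) y = c • brk a y := by simp [brk, smul_sub]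
      rw [this]; exact Submodule.smul_mem _ _ ha.2.2) ?_ hx
  intro i hi
  refine Nk_ind (P := fun y => eMat F k 0 i * y ∈ TR F k m ∧ y * eMat F k 0 i ∈ TR F k m ∧
      brk (eMat F k 0 i) y ∈ TR F k (m + 1))
    (by simp [brk])
    (fun a b ha hb => by
      refine ⟨by rw [mul_add]; exact Submodule.add_mem _ ha.1 hb.1,
        by rw [add_mul]; exact Submodule.add_mem _ ha.2.1 hb.2.1, ?_⟩
      have : brk (eMat F k 0 i) (a + b) = brk (eMat F k 0 i) a + brk (eMat F k 0 i) b := by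
        simp only [brk]; noncomm_ring
      rw [this]; exact Submodule.add_mem _ ha.2.2 hb.2.2)
    (fun c a ha => by
      refine ⟨by rw [mul_smul_comm]; exact Submodule.smul_mem _ _ ha.1,
        by rw [smul_mul_assoc]; exact Submodule.smul_mem _ _ ha.2.1, ?_⟩
      have : brk (eMat F k 0 i) (c • a) = c • brk (eMat F k 0 i) a := by simp [brk, smul_sub]
      rw [this]; exact Submodule.smul_mem _ _ ha.2.2) ?_ ?_ hy
  · intro n
    rcases Nat.eq_zero_or_pos n with rfl | hn
    · simpa [brk] using ee_TR hi
    · simp only [brk, ee_mul_pow, pow_mul_ee hn, sub_zero]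
      exact ⟨ee_TR (by omega), hz _, ee_TR (by omega)⟩
  · intro j hj
    simp [brk, ee_mul_ee (hm.trans hi), ee_mul_ee hj]

theorem brk_TR {x y : Matrix (Fin k) (Fin k) F} (hx : x ∈ NkSub F k)
    (hy : y ∈ NkSub F k) : brk x y ∈ TR F k 2 := by
  refine Nk_ind (P := fun x => brk x y ∈ TR F k 2) (by simp [brk])
    (fun a b ha hb => by
      have : brk (a + b) y = brk a y + brk b y := by simp only [brk]; noncomm_ring
      rw [this]; exact Submodule.add_mem _ ha hb)
    (fun c a ha => by
      have : brk (c • a) y = c • brk a y := by simp [brk, smul_sub]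
      rw [this]; exact Submodule.smul_mem _ _ ha) ?_ ?_ hx
  · intro m
    refine Nk_ind (P := fun y => brk (EMat F k ^ m) y ∈ TR F k 2) (by simp [brk])
      (fun a b ha hb => by
        have : brk (EMat F k ^ m) (a + b) = brk (EMat F k ^ m) a + brk (EMat F k ^ m) b := by
          simp only [brk]; noncomm_ring
        rw [this]; exact Submodule.add_mem _ ha hb)
      (fun c a ha => by
        have : brk (EMat F k ^ m) (c • a) = c • brk (EMat F k ^ m) a := by simp [brk, smul_sub]
        rw [this]; exact Submodule.smul_mem _ _ ha) ?_ ?_ hy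
    · intro n; simp [brk, ← pow_add, add_comm]
    · intro j hj
      have := (TR_mul hj (ee_TR (F := F) (k := k) le_rfl) (y := y) hy)
      rcases Nat.eq_zero_or_pos m with rfl | hm
      · simp [brk]
      · rw [brk, pow_mul_ee hm, zero_sub, ee_mul_pow]
        exact Submodule.neg_mem _ (ee_TR (by omega))
  · intro j hj
    have := (TR_mul le_rfl (ee_TR (F := F) (k := k) hj) (y := y) hy).2.2
    exact this

theorem TR_mul_TR {m n : ℕ} (hm : 1 ≤ m) {x y : Matrix (Fin k) (Fin k) F} (hx : x ∈ TR F k m)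
    (hy : y ∈ TR F k n) : x * y = 0 := by
  refine TR_ind (P := fun x => x * y = 0) (by simp)
    (fun a b ha hb => by rw [add_mul, ha, hb, add_zero])
    (fun c a ha => by rw [smul_mul_assoc, ha, smul_zero]) ?_ hx
  intro i hi
  exact TR_ind (P := fun y => eMat F k 0 i * y = 0) (by simp)
    (fun a b ha hb => by rw [mul_add, ha, hb, add_zero])
    (fun c a ha => by rw [mul_smul_comm, ha, smul_zero])
    (fun j _ => ee_mul_ee (hm.trans hi) j) hy

theorem TR_le_Nk {m : ℕ} (hm : 1 ≤ m) : TR F k m ≤ NkSub F k :=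
  Submodule.span_le.mpr (by rintro _ ⟨j, hj, rfl⟩; exact ee_mem (hm.trans hj))

theorem TR_eq_zero {m : ℕ} (hm : k ≤ m) {x : Matrix (Fin k) (Fin k) F} (hx : x ∈ TR F k m) :
    x = 0 :=
  TR_ind (m := m) (P := fun x => x = (0 : Matrix (Fin k) (Fin k) F)) rfl (fun a b ha hb => by simp [ha, hb])
    (fun c a ha => by simp [ha]) (fun _ hj => ee_zero (hm.trans hj)) hx

theorem lnc_TR (l : List (Matrix (Fin k) (Fin k) F)) (hl : ∀ x ∈ l, x ∈ NkSub F k) {m : ℕ}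
    (hm : 1 ≤ m) {x : Matrix (Fin k) (Fin k) F} (hx : x ∈ TR F k m) :
    lnc x l ∈ TR F k (m + l.length) := by
  induction l generalizing x m with
  | nil => simpa [lnc] using hx
  | cons y l ih =>
    have := ih (fun z hz => hl z (by simp [hz])) (m := m + 1) (by omega)
      (TR_mul hm hx (hl y (by simp))).2.2
    rw [List.length_cons, show m + (l.length + 1) = m + 1 + l.length by omega]
    exact this

theorem wrd_eval (c b r : ℕ → F) (l : IX) :
    wrd (fun i => c i • (1 : Matrix (Fin k) (Fin k) F) + b i • EMat F k + r i • eMat F k 0 1) l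
      = ((l.1.map c).prod * (l.2.2.2.map b).prod
          * (r l.2.1 * b l.2.2.1 - r l.2.2.1 * b l.2.1)) • eMat F k 0 (2 + l.2.2.2.length) := by
  obtain ⟨u, p, q, v⟩ := l
  have hr : ∀ j, eMat F k 0 j * EMat F k = eMat F k 0 (j + 1) := fun j => by
    simpa using ee_mul_pow (F := F) (k := k) j 1
  have hl : ∀ j, EMat F k * eMat F k 0 j = 0 := fun j => by
    simpa using pow_mul_ee (F := F) (k := k) le_rfl j
  set y := (fun i => c i • (1 : Matrix (Fin k) (Fin k) F) + b i • EMat F k + r i • eMat F k 0 1)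
    with hy
  have h1 : brk (y p) (y q) = (r p * b q - r q * b p) • eMat F k 0 2 := by
    simp only [hy, brk, add_mul, mul_add, smul_mul_assoc, mul_smul_comm, one_mul, mul_one, hl,
      hr 1, ee_mul_ee le_rfl, smul_zero, sub_smul, mul_smul]
    module
  have h2 : ∀ (v : List ℕ) (s : F) (j : ℕ), 1 ≤ j → lnc (s • eMat F k 0 j) (v.map y)
      = (s * (v.map b).prod) • eMat F k 0 (j + v.length) := by
    intro v
    induction v with
    | nil => intro s j _; simp [lnc]
    | cons i v ih =>
      intro s j hj
      have e : brk (s • eMat F k 0 j) (y i) = (s * b i) • eMat F k 0 (j + 1) := by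
        simp only [hy, brk, add_mul, mul_add, smul_mul_assoc, mul_smul_comm, one_mul, mul_one, hl,
          hr j, ee_mul_ee hj, ee_mul_ee le_rfl, smul_zero, mul_smul]
        simp only [smul_comm _ s]
        abel
      have := ih (s * b i) (j + 1) (by omega)
      rw [← e] at this
      rw [List.map_cons, show lnc (s • eMat F k 0 j) (y i :: v.map y)
        = lnc (brk (s • eMat F k 0 j) (y i)) (v.map y) from rfl, this, List.map_cons,
        List.prod_cons, List.length_cons, mul_assoc, show j + 1 + v.length = j + (v.length + 1) by omega]
  have h3 : ∀ (u : List ℕ) (j : ℕ), (u.map y).prod * eMat F k 0 j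
      = ((u.map c).prod) • eMat F k 0 j := by
    intro u j
    induction u with
    | nil => simp
    | cons i u ih =>
      rw [List.map_cons, List.prod_cons, mul_assoc, ih, mul_smul_comm]
      simp only [hy, add_mul, smul_mul_assoc, one_mul, hl, ee_mul_ee le_rfl, smul_zero, add_zero]
      rw [← mul_smul, List.map_cons, List.prod_cons, mul_comm]
  simp only [wrd]
  rw [List.map_cons, show lnc (y p) (y q :: v.map y) = lnc (brk (y p) (y q)) (v.map y) from rfl, h1,
    h2 _ _ _ (by omega), mul_smul_comm, h3, ← mul_smul]
  congr 1
  ring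

/-- entries of a polynomial in `τ + E` -/
theorem poly_entries (hk : 3 ≤ k) (τ : F) (q : Polynomial F) :
    let M := Polynomial.aeval (τ • (1 : Matrix (Fin k) (Fin k) F) + EMat F k) q
    M ⟨1, by omega⟩ ⟨0, by omega⟩ = 0 ∧ M ⟨1, by omega⟩ ⟨1, by omega⟩ = q.eval τ ∧
      M ⟨1, by omega⟩ ⟨2, by omega⟩ = q.derivative.eval τ := by
  have hE : ∀ (M : Matrix (Fin k) (Fin k) F) (i : Fin k),
      (M * EMat F k) i ⟨0, by omega⟩ = 0 ∧ (∀ j (h : j + 1 < k),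
        (M * EMat F k) i ⟨j + 1, h⟩ = M i ⟨j, by omega⟩) := by
    intro M i
    constructor
    · rw [Matrix.mul_apply, Finset.sum_eq_zero]
      intro x _
      simp [EMat]
    · intro j h
      rw [Matrix.mul_apply, Finset.sum_eq_single (⟨j, by omega⟩ : Fin k)]
      · simp [EMat]
      · intro x _ hx
        have : (x : ℕ) ≠ j := fun h => hx (Fin.ext h)
        simp [EMat, this]
      · simp
  intro M
  induction q using Polynomial.induction_on' with
  | add p q hp hq =>
    simp only [M, map_add, Matrix.add_apply, Polynomial.eval_add]
    simp only at hp hq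
    rw [hp.1, hp.2.1, hp.2.2, hq.1, hq.2.1, hq.2.2]
    simp
  | monomial n a =>
    induction n with
    | zero => simp [M, Matrix.algebraMap_matrix_apply]
    | succ n ih =>
      simp only at ih
      have : M = Polynomial.aeval (τ • (1 : Matrix (Fin k) (Fin k) F) + EMat F k)
          (Polynomial.monomial n a) * (τ • (1 : Matrix (Fin k) (Fin k) F) + EMat F k) := by
        simp only [M, Polynomial.aeval_monomial, pow_succ, mul_assoc]
      set M' := Polynomial.aeval (τ • (1 : Matrix (Fin k) (Fin k) F) + EMat F k)
          (Polynomial.monomial n a)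
      rw [this, mul_add, mul_smul_comm, mul_one]
      simp only [Matrix.add_apply, Matrix.smul_apply]
      rw [(hE M' _).1, (hE M' _).2 0, (hE M' _).2 1, ih.1, ih.2.1]
      have h3 := ih.2.2
      rw [h3]
      rw [← Polynomial.monomial_mul_X]
      simp only [Polynomial.derivative_mul, Polynomial.eval_mul, Polynomial.eval_add,
        Polynomial.derivative_X, Polynomial.eval_X, Polynomial.eval_one, smul_eq_mul]
      refine ⟨by ring, by ring, by ring⟩

end MatrixPart

section MainPart

open MvPolynomial

variable {F : Type} [Field F] {k : ℕ}

/-- abelianization killing the odd variables -/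
noncomputable def abel0 (F : Type) [Field F] : FA F →ₐ[F] MvPolynomial ℕ F :=
  FreeAlgebra.lift F (Sum.elim (fun i => X i) (fun _ => 0))

/-- kill the odd variables -/
noncomputable def killz (F : Type) [Field F] : FA F →ₐ[F] FA F :=
  FreeAlgebra.lift F (Sum.elim (fun i => yv F i) (fun _ => 0))

theorem killz_even (f : FA F) : IsEvenFA F (killz F f) := by
  have : (omegaFA F).comp (killz F) = killz F := by
    apply FreeAlgebra.hom_ext
    funext x
    rcases x with i | j <;> simp [killz, omegaFA, yv]
  exact DFunLike.congr_fun this f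

/-- the endomorphism with `y_i ↦ g i`, `z_j ↦ 0` -/
noncomputable def ysub (g : ℕ → FA F) : FA F →ₐ[F] FA F :=
  FreeAlgebra.lift F (Sum.elim g (fun _ => 0))

@[simp] theorem ysub_yv (g : ℕ → FA F) (i : ℕ) : ysub g (yv F i) = g i := by simp [ysub, yv]

theorem ysub_T2 (g : ℕ → FA F) (hg : ∀ i, IsEvenFA F (g i)) : IsT2Endo F (ysub g) :=
  ⟨fun i => by rw [ysub_yv]; exact hg i, fun j => by simp [ysub, zv, IsOddFA]⟩

theorem yv_even (i : ℕ) : IsEvenFA F (yv F i) := by simp [IsEvenFA, omegaFA, yv]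

theorem zv_odd (i : ℕ) : IsOddFA F (zv F i) := by simp [IsOddFA, omegaFA, zv]

/-- the generating set -/
def genS (F : Type) [Field F] (k : ℕ) : Set (FA F) :=
  { lnc (yv F 0) ((List.range (k - 2)).map fun i => yv F (i + 1)),
    brk (yv F 0) (yv F 1) * brk (yv F 2) (yv F 3), zv F 0 }

theorem T2_all_z {J : Submodule F (FA F)} (hJ : IsT2Ideal F J) (hz : zv F 0 ∈ J) (j : ℕ) :
    zv F j ∈ J := by
  have := hJ.2 (FreeAlgebra.lift F (Sum.elim (fun i => yv F i) (fun _ => zv F j)))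
    ⟨fun i => by simpa [yv] using yv_even (F := F) i, fun i => by
      simpa [zv] using zv_odd (F := F) j⟩ _ hz
  simpa [zv] using this

theorem sub_killz_mem {J : Submodule F (FA F)} (hJ : IsT2Ideal F J) (hz : zv F 0 ∈ J) (f : FA F) :
    f - killz F f ∈ J := by
  induction f using FreeAlgebra.induction with
  | grade0 r => simp
  | grade1 x =>
    rcases x with i | j
    · simp [killz, yv]
    · simpa [killz, zv] using T2_all_z hJ hz j
  | mul a b ha hb =>
    have : a * b - killz F (a * b) = (a - killz F a) * b + killz F a * (b - killz F b) := by
      rw [map_mul]; noncomm_ring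
    rw [this]
    exact J.add_mem (hJ.1 _ ha _).2 (hJ.1 _ hb _).1
  | add a b ha hb =>
    rw [map_add, add_sub_add_comm]; exact J.add_mem ha hb

theorem metab_mem {J : Submodule F (FA F)} (hJ : IsT2Ideal F J) (hz : zv F 0 ∈ J)
    (hb : brk (yv F 0) (yv F 1) * brk (yv F 2) (yv F 3) ∈ J) (a b c d : FA F) :
    brk a b * brk c d ∈ J := by
  let g : ℕ → FA F := fun i => killz F (if i = 0 then a else if i = 1 then b else
    if i = 2 then c else d)
  have h1 := hJ.2 (ysub g) (ysub_T2 g fun i => killz_even _) _ hb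
  have h2 : ysub g (brk (yv F 0) (yv F 1) * brk (yv F 2) (yv F 3))
      = killz F (brk a b * brk c d) := by
    simp [brk, g]
  rw [h2] at h1
  simpa using J.add_mem (sub_killz_mem hJ hz (brk a b * brk c d)) h1

theorem lnc_mem_of_mem {J : Submodule F (FA F)} (hJ : IsT2Ideal F J) (l : List (FA F)) {x : FA F}
    (hx : x ∈ J) : lnc x l ∈ J := by
  induction l generalizing x with
  | nil => exact hx
  | cons y l ih => exact ih (J.sub_mem (hJ.1 x hx y).2 (hJ.1 x hx y).1)

theorem wrd_mem {J : Submodule F (FA F)} (hJ : IsT2Ideal F J)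
    (hl : lnc (yv F 0) ((List.range (k - 2)).map fun i => yv F (i + 1)) ∈ J)
    (l : IX) (hlen : k ≤ l.2.2.2.length + 3) : wrd (yv F) l ∈ J := by
  obtain ⟨u, a, b, v⟩ := l
  simp only at hlen
  refine (hJ.1 _ ?_ _).1
  simp only
  set L := b :: v with hL
  have hLl : k - 2 ≤ L.length := by simp [hL]; omega
  rw [← List.take_append_drop (k - 2) L, List.map_append, lnc_append]
  apply lnc_mem_of_mem hJ
  let g : ℕ → FA F := fun i => yv F ((a :: L).getD i 0)
  have h1 := hJ.2 (ysub g) (ysub_T2 g fun i => yv_even _) _ hl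
  have h2 := lnc_map (ysub g).toRingHom (yv F 0) ((List.range (k - 2)).map fun i => yv F (i + 1))
  simp only [AlgHom.toRingHom_eq_coe, RingHom.coe_coe] at h2
  rw [h2] at h1
  convert h1 using 2
  · simp [g]
  · apply List.ext_getElem
    · simp; omega
    · intro i h3 h4
      simp at h3
      simp [g, List.getElem?_eq_getElem h3.2]

theorem brk_wrd (y : ℕ → FA F) (l : IX) (i : ℕ) : wrd y l * y i
    = wrd y (l.1, l.2.1, l.2.2.1, l.2.2.2 ++ [i]) + wrd y (l.1 ++ [i], l.2.1, l.2.2.1, l.2.2.2) := by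
  obtain ⟨u, a, b, v⟩ := l
  simp only [wrd]
  rw [← List.cons_append, List.map_append, lnc_append]
  set W := lnc (y a) ((b :: v).map y)
  simp only [List.map_append, List.prod_append, List.map_cons, List.map_nil, List.prod_cons,
    List.prod_nil, lnc, List.foldl_cons, List.foldl_nil, brk]
  noncomm_ring

theorem mem_of_abel0 {J : Submodule F (FA F)} (hJ : IsT2Ideal F J) (hz : zv F 0 ∈ J)
    (f : FA F) (hf : abel0 F f = 0) :
    f ∈ Submodule.span F (Set.range (wrd (yv F))) ⊔ J := by
  set K0 := Submodule.span F (Set.range (wrd (yv F))) ⊔ J with hK0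
  have hJK : J ≤ K0 := le_sup_right
  have hwK : ∀ l, wrd (yv F) l ∈ K0 := fun l =>
    (le_sup_left : _ ≤ K0) (Submodule.subset_span ⟨l, rfl⟩)
  have hgen : ∀ (a : FA F), (∀ l, a * wrd (yv F) l ∈ K0 ∧ wrd (yv F) l * a ∈ K0) →
      ∀ x ∈ K0, a * x ∈ K0 ∧ x * a ∈ K0 := by
    intro a ha x hx
    obtain ⟨w, hw, j, hj, rfl⟩ := Submodule.mem_sup.mp hx
    have hw' : a * w ∈ K0 ∧ w * a ∈ K0 := by
      refine Submodule.span_induction (p := fun w _ => a * w ∈ K0 ∧ w * a ∈ K0) ?_ (by simp) ?_ ?_ hw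
      · rintro _ ⟨l, rfl⟩; exact ha l
      · intro x y _ _ hx hy
        rw [mul_add, add_mul]
        exact ⟨K0.add_mem hx.1 hy.1, K0.add_mem hx.2 hy.2⟩
      · intro c x _ hx
        rw [mul_smul_comm, smul_mul_assoc]
        exact ⟨K0.smul_mem _ hx.1, K0.smul_mem _ hx.2⟩
    rw [mul_add, add_mul]
    exact ⟨K0.add_mem hw'.1 (hJK (hJ.1 j hj a).1), K0.add_mem hw'.2 (hJK (hJ.1 j hj a).2)⟩
  have hid : ∀ a : FA F, ∀ x ∈ K0, a * x ∈ K0 ∧ x * a ∈ K0 := by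
    intro a
    induction a using FreeAlgebra.induction with
    | grade0 r =>
      intro x hx
      rw [← Algebra.commutes, ← Algebra.smul_def]
      exact ⟨K0.smul_mem _ hx, K0.smul_mem _ hx⟩
    | grade1 x =>
      rcases x with i | j
      · refine hgen _ fun l => ⟨?_, ?_⟩
        · have : FreeAlgebra.ι F (Sum.inl i) * wrd (yv F) l = wrd (yv F) (i :: l.1, l.2) := by
            simp [wrd, yv, mul_assoc]
          rw [this]; exact hwK _
        · have := brk_wrd (yv F) l i
          rw [show FreeAlgebra.ι F (Sum.inl i) = yv F i from rfl, this]
          exact K0.add_mem (hwK _) (hwK _)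
      · have := hJ.1 _ (T2_all_z hJ hz j)
        exact fun x _ => ⟨hJK (this x).2, hJK (this x).1⟩
    | mul a b ha hb =>
      intro x hx
      rw [mul_assoc, ← mul_assoc x]
      exact ⟨(ha _ (hb x hx).1).1, (hb _ (ha x hx).2).2⟩
    | add a b ha hb =>
      intro x hx
      rw [mul_add, add_mul]
      exact ⟨K0.add_mem (ha x hx).1 (hb x hx).1, K0.add_mem (ha x hx).2 (hb x hx).2⟩
  let K : Ideal (FA F) :=
    { carrier := K0, add_mem' := K0.add_mem, zero_mem' := K0.zero_mem,
      smul_mem' := fun a x hx => (hid a x hx).1 }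
  have : K.IsTwoSided := ⟨fun b ha => (hid b _ ha).2⟩
  obtain ⟨ψ, hψ⟩ := exists_lift_of_commute F (A := FA F ⧸ K)
    (fun i : ℕ => Ideal.Quotient.mkₐ F K (yv F i)) (by
      intro i j
      rw [← map_mul, ← map_mul]
      refine Ideal.Quotient.eq.mpr ?_
      have := hwK ([], i, j, [])
      have h : yv F i * yv F j - yv F j * yv F i ∈ K0 := by
        simpa [wrd, lnc, brk] using this
      exact h)
  have hcomp : ψ.comp (abel0 F) = Ideal.Quotient.mkₐ F K := by
    apply FreeAlgebra.hom_ext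
    funext x
    rcases x with i | j
    · simp only [Function.comp, AlgHom.comp_apply, abel0, FreeAlgebra.lift_ι_apply, Sum.elim_inl, hψ]
      rfl
    · simp only [Function.comp, AlgHom.comp_apply, abel0, FreeAlgebra.lift_ι_apply, Sum.elim_inr,
        map_zero]
      exact (Ideal.Quotient.eq_zero_iff_mem.mpr (hJK (T2_all_z hJ hz j))).symm
  have h1 := DFunLike.congr_fun hcomp f
  rw [AlgHom.comp_apply, hf, map_zero] at h1
  exact Ideal.Quotient.eq_zero_iff_mem.mp h1.symm

theorem abel0_eq_zero [CharZero F] (hk : 3 ≤ k) (f : FA F)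
    (hf : f ∈ CGr F (Matrix (Fin k) (Fin k) F) (NkSub F k) ⊥) : abel0 F f = 0 := by
  apply MvPolynomial.funext
  intro c
  set p := abel0 F f with hp
  let T : MvPolynomial ℕ F →ₐ[F] Polynomial F := aeval (fun i => Polynomial.C (c i) * Polynomial.X)
  have hd : Polynomial.derivative (T p) = 0 := by
    apply Polynomial.funext
    intro τ
    let φ : FA F →ₐ[F] Matrix (Fin k) (Fin k) F :=
      FreeAlgebra.lift F (Sum.elim (fun i => c i • (τ • (1 : Matrix (Fin k) (Fin k) F) + EMat F k))
        (fun _ => 0))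
    have hφ : IsGSubst F _ (NkSub F k) ⊥ φ := by
      constructor
      · intro i
        simp only [φ, yv, FreeAlgebra.lift_ι_apply, Sum.elim_inl]
        refine Submodule.smul_mem _ _ (Submodule.add_mem _ (Submodule.smul_mem _ _ ?_) ?_)
        · simpa using pow_mem' (F := F) hk 0
        · simpa using pow_mem' (F := F) hk 1
      · intro j
        simp [φ, zv]
    have hφ' : φ = ((Polynomial.aeval (τ • (1 : Matrix (Fin k) (Fin k) F) + EMat F k)).comp T).comp
        (abel0 F) := by
      apply FreeAlgebra.hom_ext
      funext x
      rcases x with i | j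
      · simp [φ, T, abel0, Algebra.smul_def]
      · simp [φ, T, abel0]
    have h1 := (hf.2 φ hφ).2 (eMat F k 0 1) (Submodule.mem_sup_left (ee_mem le_rfl))
    have h2 := (poly_entries hk τ (T p)).2.2
    have h3 : φ f = Polynomial.aeval (τ • (1 : Matrix (Fin k) (Fin k) F) + EMat F k) (T p) := by
      rw [hφ']; rfl
    rw [← h3] at h2
    have h4 := congrFun (congrFun h1 ⟨0, by omega⟩) ⟨2, by omega⟩
    rw [ee_mul_apply, dif_pos (by omega), if_pos rfl, h2, Matrix.mul_apply,
      Finset.sum_eq_zero] at h4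
    · rw [← h4]; simp
    · intro x _
      simp [eMat]
  have h5 := Polynomial.eq_C_of_derivative_eq_zero hd
  have e1 : Polynomial.eval 1 (T p) = eval c p := by
    have : (Polynomial.aeval (1 : F)).comp T = aeval c := by
      apply MvPolynomial.algHom_ext
      intro i; simp [T]
    have := DFunLike.congr_fun this p
    simpa [Polynomial.coe_aeval_eq_eval, MvPolynomial.coe_aeval_eq_eval] using this
  have e0 : Polynomial.eval 0 (T p) = 0 := by
    have : ((Polynomial.aeval (0 : F)).comp T).comp (abel0 F) = constTerm F := by
      apply FreeAlgebra.hom_ext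
      funext x
      rcases x with i | j <;> simp [T, abel0, constTerm]
    have := DFunLike.congr_fun this f
    rw [hf.1] at this
    simpa [Polynomial.coe_aeval_eq_eval] using this
  rw [h5, Polynomial.eval_C] at e0 e1
  rw [← e1, e0, map_zero]

theorem smon_eval (c b : ℕ → F) (l : IX) :
    eval (Sum.elim c b) (smon F l) = (l.1.map c).prod * (l.2.2.2.map b).prod := by
  simp only [smon, map_mul, map_list_prod, List.map_map]
  congr 3 <;> (funext i; simp)

theorem wrd_map (φ : FA F →ₐ[F] Matrix (Fin k) (Fin k) F) (l : IX) :
    φ (wrd (yv F) l) = wrd (fun i => φ (yv F i)) l := by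
  simp only [wrd, map_mul, map_list_prod, List.map_map]
  have := lnc_map φ.toRingHom (yv F l.2.1) ((l.2.2.1 :: l.2.2.2).map (yv F))
  simp only [AlgHom.toRingHom_eq_coe, RingHom.coe_coe, List.map_map] at this
  rw [this]
  rfl

theorem coeff_vanish [CharZero F] (hk : 3 ≤ k) (c : IX →₀ F)
    (hg : (c.sum fun l a => a • wrd (yv F) l) ∈ CGr F (Matrix (Fin k) (Fin k) F) (NkSub F k) ⊥)
    (n : ℕ) (hn : n + 4 ≤ k) (j : ℕ) :
    ∑ l ∈ c.support.filter (fun l => l.2.2.2.length = n), c l • (smon F l *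
      ((if l.2.1 = j then X (Sum.inr l.2.2.1) else 0)
      - (if l.2.2.1 = j then X (Sum.inr l.2.1) else 0))) = 0 := by
  apply MvPolynomial.funext
  intro x
  let r : ℕ → F := fun i => if i = j then 1 else 0
  let cc : ℕ → F := fun i => x (Sum.inl i)
  let b : ℕ → F := fun i => x (Sum.inr i)
  have hx : x = Sum.elim cc b := by funext i; rcases i with i | i <;> rfl
  let φ : FA F →ₐ[F] Matrix (Fin k) (Fin k) F :=
    FreeAlgebra.lift F (Sum.elim (fun i => cc i • (1 : Matrix (Fin k) (Fin k) F) + b i • EMat F k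
      + r i • eMat F k 0 1) (fun _ => 0))
  have hφ : IsGSubst F _ (NkSub F k) ⊥ φ := by
    constructor
    · intro i
      simp only [φ, yv, FreeAlgebra.lift_ι_apply, Sum.elim_inl]
      refine Submodule.add_mem _ (Submodule.add_mem _ (Submodule.smul_mem _ _ ?_)
        (Submodule.smul_mem _ _ ?_)) (Submodule.smul_mem _ _ (ee_mem le_rfl))
      · simpa using pow_mem' (F := F) hk 0
      · simpa using pow_mem' (F := F) hk 1
    · intro j
      simp [φ, zv]
  have hE : EMat F k ∈ NkSub F k ⊔ ⊥ := Submodule.mem_sup_left (by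
    simpa using pow_mem' (F := F) hk 1)
  have h1 := (hg.2 φ hφ).2 _ hE
  have hy : (fun i => φ (yv F i)) = fun i => cc i • (1 : Matrix (Fin k) (Fin k) F)
      + b i • EMat F k + r i • eMat F k 0 1 := by
    funext i; simp [φ, yv]
  rw [Finsupp.sum, map_sum] at h1
  simp only [map_smul, wrd_map, hy, wrd_eval] at h1
  have hr : ∀ j, eMat F k 0 j * EMat F k = eMat F k 0 (j + 1) := fun j => by
    simpa using ee_mul_pow (F := F) (k := k) j 1
  have hl : ∀ j, EMat F k * eMat F k 0 j = 0 := fun j => by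
    simpa using pow_mul_ee (F := F) (k := k) le_rfl j
  simp only [Finset.sum_mul, Finset.mul_sum, smul_mul_assoc, mul_smul_comm, hr, hl, smul_zero,
    Finset.sum_const_zero] at h1
  have h2 := congrFun (congrFun h1 ⟨0, by omega⟩) ⟨n + 3, by omega⟩
  rw [Matrix.sum_apply, Matrix.zero_apply] at h2
  rw [map_zero, map_sum, Finset.sum_filter]
  refine Eq.trans ?_ h2
  refine Finset.sum_congr rfl fun l _ => ?_
  simp only [Matrix.smul_apply, eMat, Matrix.of_apply, true_and, smul_eq_mul]
  by_cases h : l.2.2.2.length = n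
  · rw [if_pos h, if_pos (show n + 3 = 2 + l.2.2.2.length + 1 by omega), smul_eval, map_mul, hx, smon_eval, map_sub]
    have e1 : eval (Sum.elim cc b) (if l.2.1 = j then (X (Sum.inr l.2.2.1) : SS F) else 0)
        = r l.2.1 * b l.2.2.1 := by simp only [r]; split_ifs <;> simp
    have e2 : eval (Sum.elim cc b) (if l.2.2.1 = j then (X (Sum.inr l.2.1) : SS F) else 0)
        = r l.2.2.1 * b l.2.1 := by simp only [r]; split_ifs <;> simp
    rw [e1, e2, mul_one]
  · rw [if_neg h, if_neg (show ¬ n + 3 = 2 + l.2.2.2.length + 1 by omega)]; simp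

theorem hard_dir [CharZero F] (hk : 3 ≤ k) {J : Submodule F (FA F)} (hJ : IsT2Ideal F J)
    (hS : genS F k ⊆ J) (hJC : J ≤ CGr F (Matrix (Fin k) (Fin k) F) (NkSub F k) ⊥) :
    CGr F (Matrix (Fin k) (Fin k) F) (NkSub F k) ⊥ ≤ J := by
  intro f hf
  have hl : lnc (yv F 0) ((List.range (k - 2)).map fun i => yv F (i + 1)) ∈ J :=
    hS (Or.inl rfl)
  have hb : brk (yv F 0) (yv F 1) * brk (yv F 2) (yv F 3) ∈ J := hS (Or.inr (Or.inl rfl))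
  have hz : zv F 0 ∈ J := hS (Or.inr (Or.inr rfl))
  obtain ⟨g, hg, j, hj, rfl⟩ := Submodule.mem_sup.mp
    (mem_of_abel0 hJ hz f (abel0_eq_zero hk f hf))
  refine J.add_mem ?_ hj
  have hgC : g ∈ CGr F (Matrix (Fin k) (Fin k) F) (NkSub F k) ⊥ := by
    have := Submodule.sub_mem _ hf (hJC hj)
    simpa using this
  obtain ⟨c, rfl⟩ := Finsupp.mem_span_range_iff_exists_finsupp.mp hg
  let K : Ideal (FA F) :=
    { carrier := J, add_mem' := J.add_mem, zero_mem' := J.zero_mem,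
      smul_mem' := fun a x hx => (hJ.1 x hx a).1 }
  have : K.IsTwoSided := ⟨fun b ha => (hJ.1 _ ha b).2⟩
  have hmk : ∀ x, Ideal.Quotient.mkₐ F K x = 0 ↔ x ∈ J := fun x =>
    Ideal.Quotient.eq_zero_iff_mem
  have hQ : ∀ a b c d : FA F ⧸ K, brk a b * brk c d = 0 := by
    intro a b c d
    obtain ⟨a, rfl⟩ := Ideal.Quotient.mkₐ_surjective F K a
    obtain ⟨b, rfl⟩ := Ideal.Quotient.mkₐ_surjective F K b
    obtain ⟨c, rfl⟩ := Ideal.Quotient.mkₐ_surjective F K c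
    obtain ⟨d, rfl⟩ := Ideal.Quotient.mkₐ_surjective F K d
    have := (hmk _).mpr (metab_mem hJ hz hb a b c d)
    simpa only [brk, map_mul, map_sub] using this
  have hfib : ∀ n, ∑ l ∈ c.support.filter (fun l => l.2.2.2.length = n),
      c l • wrd (yv F) l ∈ J := by
    intro n
    by_cases hn : n + 4 ≤ k
    · have h1 := metab_core hQ (fun i => Ideal.Quotient.mkₐ F K (yv F i)) n
        (c.support.filter (fun l => l.2.2.2.length = n)) c
        (fun l hl => (Finset.mem_filter.mp hl).2) (coeff_vanish hk c hgC n hn)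
      rw [← hmk, map_sum, ← h1]
      refine Finset.sum_congr rfl fun l _ => ?_
      rw [map_smul]
      congr 1
      simp only [wrd, map_mul, map_list_prod, List.map_map]
      have := lnc_map (Ideal.Quotient.mkₐ F K).toRingHom (yv F l.2.1)
        ((l.2.2.1 :: l.2.2.2).map (yv F))
      simp only [AlgHom.toRingHom_eq_coe, RingHom.coe_coe, List.map_map] at this
      rw [this]
      rfl
    · refine J.sum_mem fun l hl' => J.smul_mem _ (wrd_mem hJ hl l ?_)
      have := (Finset.mem_filter.mp hl').2
      omega
  rw [Finsupp.sum, ← Finset.sum_fiberwise_of_maps_to (s := c.support)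
    (t := c.support.image fun l => l.2.2.2.length) (g := fun l => l.2.2.2.length)
    (fun l hl => Finset.mem_image_of_mem _ hl)]
  exact J.sum_mem fun n _ => hfib n

/-- the ideal of polynomials all of whose values lie in `F e_{1k}` -/
def Icen (F : Type) [Field F] (k : ℕ) : Submodule F (FA F) where
  carrier := {f | ∀ φ : FA F →ₐ[F] Matrix (Fin k) (Fin k) F, IsGSubst F _ (NkSub F k) ⊥ φ →
    φ f ∈ TR F k (k - 1)}
  add_mem' := fun {f g} hf hg φ hφ => by
    rw [map_add]; exact Submodule.add_mem _ (hf φ hφ) (hg φ hφ)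
  zero_mem' := fun φ _ => by rw [map_zero]; exact Submodule.zero_mem _
  smul_mem' := fun c f hf φ hφ => by rw [map_smul]; exact Submodule.smul_mem _ _ (hf φ hφ)

theorem val_mem (hk : 3 ≤ k) {φ : FA F →ₐ[F] Matrix (Fin k) (Fin k) F}
    (hφ : IsGSubst F _ (NkSub F k) ⊥ φ) (f : FA F) : φ f ∈ NkSub F k := by
  induction f using FreeAlgebra.induction with
  | grade0 r =>
    rw [AlgHom.commutes, Algebra.algebraMap_eq_smul_one]
    exact Submodule.smul_mem _ _ (by simpa using pow_mem' (F := F) hk 0)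
  | grade1 x =>
    rcases x with i | j
    · exact hφ.1 i
    · have := hφ.2 j
      rw [Submodule.mem_bot] at this
      rw [show FreeAlgebra.ι F (Sum.inr j) = zv F j from rfl, this]
      exact Submodule.zero_mem _
  | mul a b ha hb => rw [map_mul]; exact Nk_mul hk ha hb
  | add a b ha hb => rw [map_add]; exact Submodule.add_mem _ ha hb

theorem Icen_T2 [CharZero F] (hk : 3 ≤ k) : IsT2Ideal F (Icen F k) := by
  constructor
  · intro f hf g
    constructor <;> intro φ hφ <;> rw [map_mul]
    · exact (TR_mul (by omega) (hf φ hφ) (val_mem hk hφ g)).2.1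
    · exact (TR_mul (by omega) (hf φ hφ) (val_mem hk hφ g)).1
  · intro ψ hψ f hf φ hφ
    refine hf (φ.comp ψ) ⟨fun i => val_mem hk hφ _, fun j => ?_⟩
    have h1 : φ.comp (omegaFA F) = φ := by
      apply FreeAlgebra.hom_ext
      funext x
      rcases x with i | j
      · simp [omegaFA]
      · have := hφ.2 j
        rw [Submodule.mem_bot, zv] at this
        simp [omegaFA, this]
    have h2 := DFunLike.congr_fun h1 (ψ (zv F j))
    rw [AlgHom.comp_apply, hψ.2 j, map_neg] at h2
    rw [Submodule.mem_bot, AlgHom.comp_apply]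
    ext a b
    have h3 := congrFun (congrFun h2 a) b
    simp only [Matrix.neg_apply] at h3
    exact self_eq_neg.mp h3.symm

theorem Icen_gen (hk : 3 ≤ k) : genS F k ⊆ Icen F k := by
  rintro f (rfl | rfl | rfl) φ hφ
  · have := lnc_map φ.toRingHom (yv F 0) ((List.range (k - 2)).map fun i => yv F (i + 1))
    simp only [AlgHom.toRingHom_eq_coe, RingHom.coe_coe] at this
    rw [this]
    obtain ⟨m, rfl⟩ : ∃ m, k = m + 3 := ⟨k - 3, by omega⟩
    rw [show m + 3 - 2 = m + 1 by omega, List.range_succ_eq_map]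
    simp only [List.map_cons, List.map_map]
    have h2 := lnc_TR (F := F) (k := m + 3)
      ((List.range m).map (φ ∘ (fun i => yv F (i + 1)) ∘ Nat.succ)) (by
        intro x hx
        obtain ⟨i, _, rfl⟩ := List.mem_map.mp hx
        exact val_mem hk hφ _) (m := 2) (by omega)
      (brk_TR (val_mem hk hφ (yv F 0)) (val_mem hk hφ (yv F (0 + 1))))
    rw [List.length_map, List.length_range] at h2
    rw [show m + 3 - 1 = 2 + m by omega]
    exact h2
  · rw [map_mul]
    have h : ∀ a b : FA F, φ (brk a b) ∈ TR F k 2 := fun a b => by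
      have := brk_TR (val_mem hk hφ a) (val_mem hk hφ b)
      simpa [brk] using this
    rw [TR_mul_TR (by omega) (h _ _) (h _ _)]
    exact Submodule.zero_mem _
  · have := hφ.2 0
    rw [Submodule.mem_bot] at this
    rw [this]; exact Submodule.zero_mem _

theorem Icen_le (hk : 3 ≤ k) :
    Icen F k ≤ CGr F (Matrix (Fin k) (Fin k) F) (NkSub F k) ⊥ := by
  intro f hf
  refine ⟨?_, fun φ hφ => ⟨Submodule.mem_sup_left (val_mem hk hφ f), fun y hy => ?_⟩⟩
  · let φ : FA F →ₐ[F] Matrix (Fin k) (Fin k) F := (Algebra.ofId F _).comp (constTerm F)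
    have hφ : IsGSubst F _ (NkSub F k) ⊥ φ :=
      ⟨fun i => by simp [φ, constTerm, yv], fun j => by simp [φ, constTerm, zv]⟩
    have h1 := hf φ hφ
    have h2 : ∀ x ∈ TR F k (k - 1), x (⟨0, by omega⟩ : Fin k) ⟨0, by omega⟩ = 0 := by
      intro x hx
      refine TR_ind (P := fun x => x (⟨0, by omega⟩ : Fin k) ⟨0, by omega⟩ = 0) rfl ?_ ?_ ?_ hx
      · intro a b ha hb; rw [Matrix.add_apply, ha, hb, add_zero]
      · intro c a ha; rw [Matrix.smul_apply, ha, smul_zero]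
      · intro j hj
        simp only [eMat, Matrix.of_apply]
        rw [if_neg]; omega
    have h3 := h2 _ h1
    simpa [φ, Algebra.ofId_apply, Matrix.algebraMap_matrix_apply] using h3
  · rw [sup_bot_eq] at hy
    have := TR_eq_zero (by omega) (TR_mul (by omega) (hf φ hφ) hy).2.2
    exact sub_eq_zero.mp this

end MainPart

/-- for `k ≥ 3`, `C^gr(N_k)` (trivial grading) is the T₂-ideal
generated by `[y₁,…,y_{k-1}]`, `[y₁,y₂][y₃,y₄]` and `z₁`. -/
theorem stmt6 (F : Type) [Field F] [CharZero F] (k : ℕ) (hk : 3 ≤ k) :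
    CGr F (Matrix (Fin k) (Fin k) F) (NkSub F k) ⊥ =
      T2IdealGen F
        { lnc (yv F 0) ((List.range (k - 2)).map fun i => yv F (i + 1)),
          brk (yv F 0) (yv F 1) * brk (yv F 2) (yv F 3),
          zv F 0 } := by
  have hT : IsT2Ideal F (T2IdealGen F (genS F k)) := by
    constructor
    · intro f hf g
      rw [T2IdealGen, Submodule.mem_sInf] at hf
      constructor <;> rw [T2IdealGen, Submodule.mem_sInf] <;> intro I hI
      · exact (hI.2.1 f (hf I hI) g).1
      · exact (hI.2.1 f (hf I hI) g).2
    · intro φ hφ f hf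
      rw [T2IdealGen, Submodule.mem_sInf] at hf ⊢
      exact fun I hI => hI.2.2 φ hφ f (hf I hI)
  have hS : genS F k ⊆ T2IdealGen F (genS F k) := by
    intro f hf
    rw [SetLike.mem_coe, T2IdealGen, Submodule.mem_sInf]
    exact fun I hI => hI.1 hf
  have hle : T2IdealGen F (genS F k) ≤ CGr F (Matrix (Fin k) (Fin k) F) (NkSub F k) ⊥ :=
    (sInf_le ⟨Icen_gen hk, Icen_T2 hk⟩ : T2IdealGen F (genS F k) ≤ Icen F k).trans (Icen_le hk)
  exact le_antisymm (hard_dir hk hT hS hle) hle
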